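/- Fix (ξ, ζ) ∈ D^{J+K}, T > 0, and δ ∈ (0, T) with 2δηJK < 1. Let y^0 ≡ 0 and, for n ≥ 1 and k ∈ [K], y_k^n := ζ_k − η_k ∫_0^· y_k^{n−1}(s) ds − Σ_{j=1}^J p_{jk} ψ( ξ_j + Σ_{l=1}^K q_{lj} η_l ∫_0^· y_l^{n−1}(s) ds ), and set C_t := max_{k∈[K]} ‖ζ_k‖_t + Σ_{j=1}^J ‖ψ(ξ_j)‖_t for t > 0. Then for every n ≥ 1 and every k ∈ [K], ‖y_k^n − y_k^{n−1}‖_δ ≤ (2δηJK)^{n−1} C_δ. -/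

import Mathlib

open MeasureTheory Set Filter

/-- One-sided reflection map: `psi x t = sup_{s ∈ [0,t]} max (-x s) 0`. -/
noncomputable def psi (x : ℝ → ℝ) (t : ℝ) : ℝ :=
  sSup ((fun s => max (-x s) 0) '' Set.Icc 0 t)

/-- `phi x t = x t + psi x t`. -/
noncomputable def phi (x : ℝ → ℝ) (t : ℝ) : ℝ := x t + psi x t

/-- Càdlàg on `[0,∞)`: right continuous on `[0,∞)`, left limits on `(0,∞)`. -/
def Cadlag (x : ℝ → ℝ) : Prop :=
  (∀ t : ℝ, 0 ≤ t → ContinuousWithinAt x (Set.Ici t) t) ∧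
  (∀ t : ℝ, 0 < t → ∃ L : ℝ, Filter.Tendsto x (nhdsWithin t (Set.Iio t)) (nhds L))

/-- Càdlàg on `[0,T]`: right continuous on `[0,T)`, left limits on `(0,T]`. -/
def CadlagOn (x : ℝ → ℝ) (T : ℝ) : Prop :=
  (∀ t : ℝ, 0 ≤ t → t < T → ContinuousWithinAt x (Set.Ici t) t) ∧
  (∀ t : ℝ, 0 < t → t ≤ T → ∃ L : ℝ, Filter.Tendsto x (nhdsWithin t (Set.Iio t)) (nhds L))

/-- Sup norm of `x` on `[0,T]`. -/
noncomputable def supNorm (x : ℝ → ℝ) (T : ℝ) : ℝ :=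
  sSup ((fun t => |x t|) '' Set.Icc 0 T)

/-- `y` is a càdlàg solution of equation (A.1) on `[0,∞)` for input `(ξ, ζ)`. -/
def IsSolA1 {J K : ℕ} (η : Fin K → ℝ) (p : Fin J → Fin K → ℝ) (q : Fin K → Fin J → ℝ)
    (ξ : Fin J → ℝ → ℝ) (ζ : Fin K → ℝ → ℝ) (y : Fin K → ℝ → ℝ) : Prop :=
  (∀ k, Cadlag (y k)) ∧
  ∀ k, ∀ t : ℝ, 0 ≤ t →
    y k t = ζ k t - η k * (∫ s in (0:ℝ)..t, y k s)
      - ∑ j, p j k *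
          psi (fun r => ξ j r + ∑ l, q l j * η l * (∫ s in (0:ℝ)..r, y l s)) t

/-- `f` is almost everywhere measurable and bounded on `[0,δ]`. -/
def BddMeasOn (f : ℝ → ℝ) (δ : ℝ) : Prop :=
  AEStronglyMeasurable f (volume.restrict (Set.Icc 0 δ)) ∧ ∃ C : ℝ, ∀ t ∈ Set.Icc 0 δ, |f t| ≤ C

theorem measurable_of_continuousWithinAt_Ici {f : ℝ → ℝ}
    (hf : ∀ t, ContinuousWithinAt f (Set.Ici t) t) : Measurable f := by
  have hmeas : ∀ n : ℕ, Measurable (fun t : ℝ => f (((⌊(n + 1 : ℝ) * t⌋ : ℝ) + 1) / (n + 1))) := by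
    intro n
    have h1 : Measurable (fun t : ℝ => ⌊(n + 1 : ℝ) * t⌋) :=
      Int.measurable_floor.comp (measurable_const.mul measurable_id)
    exact (measurable_of_countable (fun z : ℤ => f (((z : ℝ) + 1) / (n + 1)))).comp h1
  refine measurable_of_tendsto_metrizable hmeas (tendsto_pi_nhds.2 fun t => ?_)
  refine (hf t).tendsto.comp (tendsto_nhdsWithin_iff.2 ⟨?_, Eventually.of_forall fun n => ?_⟩)
  · have hlim : Tendsto (fun n : ℕ => t + 1 / ((n : ℝ) + 1)) atTop (nhds t) := by
      simpa using (tendsto_const_nhds (x := t)).add tendsto_one_div_add_atTop_nhds_zero_nat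
    refine tendsto_of_tendsto_of_tendsto_of_le_of_le tendsto_const_nhds hlim
      (fun n => ?_) (fun n => ?_)
    · have hn : (0 : ℝ) < n + 1 := by positivity
      simp only
      rw [le_div_iff₀ hn]
      linarith [Int.lt_floor_add_one ((n + 1 : ℝ) * t)]
    · have hn : (0 : ℝ) < n + 1 := by positivity
      simp only
      rw [div_le_iff₀ hn, add_mul t, one_div_mul_cancel hn.ne']
      linarith [Int.floor_le ((n + 1 : ℝ) * t)]
  · have hn : (0 : ℝ) < n + 1 := by positivity
    rw [Set.mem_Ici, le_div_iff₀ hn]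
    linarith [Int.lt_floor_add_one ((n + 1 : ℝ) * t)]

theorem Cadlag.exists_bound {f : ℝ → ℝ} (hf : Cadlag f) (δ : ℝ) :
    ∃ C : ℝ, ∀ t ∈ Set.Icc 0 δ, |f t| ≤ C := by
  have hbdd : ∀ {l : Filter ℝ} {L : ℝ}, Tendsto f l (nhds L) → ∀ᶠ s in l, |f s| ≤ |L| + 1 := by
    intro l L h
    exact (h.abs.eventually (gt_mem_nhds (lt_add_one |L|))).mono fun _ h => le_of_lt h
  refine isCompact_Icc.induction_on (p := fun s => ∃ C : ℝ, ∀ t ∈ s, |f t| ≤ C) ⟨0, by simp⟩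
    (fun s t hst ⟨C, hC⟩ => ⟨C, fun x hx => hC x (hst hx)⟩) ?_ ?_
  · rintro s t ⟨C, hC⟩ ⟨D, hD⟩
    refine ⟨max C D, ?_⟩
    rintro x (hx | hx)
    · exact (hC x hx).trans (le_max_left _ _)
    · exact (hD x hx).trans (le_max_right _ _)
  · intro t ht
    have hr := hbdd (hf.1 t ht.1)
    rcases ht.1.eq_or_lt with h | h
    · subst h
      exact ⟨_, nhdsWithin_mono _ Set.Icc_subset_Ici_self hr, _, fun _ h => h⟩
    · obtain ⟨L, hL⟩ := hf.2 t h
      have hl := hbdd hL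
      refine ⟨{s | |f s| ≤ max (|L| + 1) (|f t| + 1)}, mem_nhdsWithin_of_mem_nhds ?_, _,
        fun _ h => h⟩
      rw [← nhdsLT_sup_nhdsGE t]
      exact Filter.mem_sup.2 ⟨hl.mono fun _ h => h.trans (le_max_left _ _),
        hr.mono fun _ h => h.trans (le_max_right _ _)⟩

theorem Cadlag.bddMeasOn {f : ℝ → ℝ} (hf : Cadlag f) (δ : ℝ) : BddMeasOn f δ := by
  refine ⟨?_, hf.exists_bound δ⟩
  have h : Measurable (fun t => f (max t 0)) := by
    refine measurable_of_continuousWithinAt_Ici fun t => ?_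
    refine ContinuousWithinAt.comp (t := Set.Ici (max t 0)) (hf.1 _ (le_max_right _ _))
      (by fun_prop) fun s hs => Set.mem_Ici.2 (max_le_max_right 0 hs)
  refine h.aestronglyMeasurable.congr ?_
  filter_upwards [ae_restrict_mem measurableSet_Icc] with t ht
  rw [max_eq_left ht.1]

namespace BddMeasOn

variable {f g : ℝ → ℝ} {δ : ℝ}

theorem add (hf : BddMeasOn f δ) (hg : BddMeasOn g δ) : BddMeasOn (fun t => f t + g t) δ := by
  obtain ⟨hf, C, hC⟩ := hf
  obtain ⟨hg, D, hD⟩ := hg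
  exact ⟨hf.add hg, C + D, fun t ht => (abs_add_le _ _).trans (add_le_add (hC t ht) (hD t ht))⟩

theorem const_mul (hf : BddMeasOn f δ) (c : ℝ) : BddMeasOn (fun t => c * f t) δ := by
  obtain ⟨hf, C, hC⟩ := hf
  refine ⟨hf.const_mul c, |c| * C, fun t ht => ?_⟩
  rw [abs_mul]
  exact mul_le_mul_of_nonneg_left (hC t ht) (abs_nonneg c)

theorem sub (hf : BddMeasOn f δ) (hg : BddMeasOn g δ) : BddMeasOn (fun t => f t - g t) δ := by
  simpa [sub_eq_add_neg] using hf.add (hg.const_mul (-1))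

theorem sum {ι : Type*} (s : Finset ι) {F : ι → ℝ → ℝ} (hF : ∀ i, BddMeasOn (F i) δ) :
    BddMeasOn (fun t => ∑ i ∈ s, F i t) δ := by
  classical
  induction s using Finset.induction_on with
  | empty => exact ⟨by simpa using aestronglyMeasurable_const, 0, by simp⟩
  | insert a s ha ih => simpa only [Finset.sum_insert ha] using (hF a).add ih

theorem integrableOn (hf : BddMeasOn f δ) : IntegrableOn f (Set.Icc 0 δ) := by
  obtain ⟨hf, C, hC⟩ := hf
  exact Integrable.of_bound hf C ((ae_restrict_mem measurableSet_Icc).mono hC)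

theorem intervalIntegrable (hf : BddMeasOn f δ) {t : ℝ} (ht : t ∈ Set.Icc 0 δ) :
    IntervalIntegrable f volume 0 t :=
  (intervalIntegrable_iff_integrableOn_Icc_of_le ht.1).2
    (hf.integrableOn.mono_set (Set.Icc_subset_Icc_right ht.2))

theorem integral (hf : BddMeasOn f δ) : BddMeasOn (fun t => ∫ s in (0 : ℝ)..t, f s) δ := by
  rcases lt_or_ge δ 0 with h | h
  · exact ⟨by simp [Set.Icc_eq_empty_of_lt h], 0,
      by simp [Set.Icc_eq_empty_of_lt h]⟩
  have hc : ContinuousOn (fun t => ∫ s in (0 : ℝ)..t, f s) (Set.Icc 0 δ) := by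
    have := intervalIntegral.continuousOn_primitive_interval (μ := volume) (f := f) (a := 0)
      (b := δ) (by simpa [Set.uIcc_of_le h] using hf.integrableOn)
    simpa [Set.uIcc_of_le h] using this
  exact ⟨hc.aestronglyMeasurable measurableSet_Icc, isCompact_Icc.exists_bound_of_continuousOn hc⟩

theorem bddAbove_reflection (hf : BddMeasOn f δ) {t : ℝ} (ht : t ≤ δ) :
    BddAbove ((fun s => max (-f s) 0) '' Set.Icc 0 t) := by
  obtain ⟨C, hC⟩ := hf.2
  refine ⟨max C 0, ?_⟩
  rintro _ ⟨s, hs, rfl⟩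
  exact max_le_max_right 0 ((neg_le_abs _).trans (hC s ⟨hs.1, hs.2.trans ht⟩))

theorem psi_le (hg : BddMeasOn g δ) {t B : ℝ} (ht : t ∈ Set.Icc 0 δ)
    (hB : ∀ s ∈ Set.Icc 0 t, |f s - g s| ≤ B) : psi f t ≤ psi g t + B := by
  refine csSup_le ((Set.nonempty_Icc.2 ht.1).image _) ?_
  rintro _ ⟨s, hs, rfl⟩
  have h1 : max (-g s) 0 ≤ psi g t :=
    le_csSup (hg.bddAbove_reflection ht.2) (Set.mem_image_of_mem _ hs)
  have h2 := abs_le.1 (hB s hs)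
  have h3 := max_le_iff.1 h1
  exact max_le (by linarith) (by linarith)

theorem abs_psi_sub_psi_le (hf : BddMeasOn f δ) (hg : BddMeasOn g δ) {t B : ℝ}
    (ht : t ∈ Set.Icc 0 δ) (hB : ∀ s ∈ Set.Icc 0 t, |f s - g s| ≤ B) :
    |psi f t - psi g t| ≤ B := by
  have h1 := hg.psi_le ht hB
  have h2 := hf.psi_le ht fun s hs => by simpa [abs_sub_comm] using hB s hs
  exact abs_le.2 ⟨by linarith, by linarith⟩

theorem psi (hf : BddMeasOn f δ) : BddMeasOn (psi f) δ := by
  have hmono : MonotoneOn (_root_.psi f) (Set.Icc 0 δ) := fun s hs t ht hst =>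
    csSup_le_csSup (hf.bddAbove_reflection ht.2) ((Set.nonempty_Icc.2 hs.1).image _)
      (Set.image_mono (Set.Icc_subset_Icc_right hst))
  refine ⟨(aemeasurable_restrict_of_monotoneOn measurableSet_Icc hmono).aestronglyMeasurable,
    _root_.psi f δ, fun t ht => ?_⟩
  have h0 : 0 ≤ _root_.psi f t :=
    Real.sSup_nonneg (by rintro _ ⟨s, -, rfl⟩; exact le_max_right _ _)
  rw [abs_of_nonneg h0]
  exact hmono ht ⟨ht.1.trans ht.2, le_rfl⟩ ht.2

theorem abs_le_supNorm (hf : BddMeasOn f δ) {t : ℝ} (ht : t ∈ Set.Icc 0 δ) :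
    |f t| ≤ supNorm f δ := by
  obtain ⟨C, hC⟩ := hf.2
  exact le_csSup ⟨C, by rintro _ ⟨s, hs, rfl⟩; exact hC s hs⟩ (Set.mem_image_of_mem _ ht)

theorem abs_integral_sub_integral_le (hf : BddMeasOn f δ) (hg : BddMeasOn g δ) {t B : ℝ}
    (ht : t ∈ Set.Icc 0 δ) (hB : ∀ s ∈ Set.Icc 0 δ, |f s - g s| ≤ B) :
    |(∫ s in (0 : ℝ)..t, f s) - ∫ s in (0 : ℝ)..t, g s| ≤ B * δ := by
  have hB0 : 0 ≤ B := (abs_nonneg _).trans (hB t ht)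
  rw [← intervalIntegral.integral_sub (hf.intervalIntegrable ht) (hg.intervalIntegrable ht)]
  refine (intervalIntegral.norm_integral_le_of_norm_le_const (E := ℝ) (C := B) fun s hs => ?_).trans ?_
  · rw [Set.uIoc_of_le ht.1] at hs
    exact hB s ⟨hs.1.le, hs.2.trans ht.2⟩
  · rw [sub_zero, abs_of_nonneg ht.1]
    exact mul_le_mul_of_nonneg_left ht.2 hB0

end BddMeasOn

/-- Estimate (B.21): for `δ ∈ (0,T)` with `2δηJK < 1` (where `η = max_k η_k`),
`‖y_k^n − y_k^{n−1}‖_δ ≤ (2δηJK)^{n−1} C_δ`, where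
`C_t = max_k ‖ζ_k‖_t + Σ_j ‖ψ(ξ_j)‖_t`. -/
theorem stmt6
    (J K : ℕ) (hJ : 0 < J) (hK : 0 < K)
    (μ : Fin J → ℝ) (hμ : ∀ j, 0 < μ j)
    (η : Fin K → ℝ) (hη : ∀ k, 0 < η k)
    (p : Fin J → Fin K → ℝ) (hp : ∀ j k, 0 ≤ p j k) (hprow : ∀ j, ∑ k, p j k = 1)
    (q : Fin K → Fin J → ℝ) (hq : ∀ k j, 0 ≤ q k j) (hqrow : ∀ k, ∑ j, q k j = 1)
    (ξ : Fin J → ℝ → ℝ) (hξ : ∀ j, Cadlag (ξ j))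
    (ζ : Fin K → ℝ → ℝ) (hζ : ∀ k, Cadlag (ζ k))
    (T δ : ℝ) (hT : 0 < T) (hδ : 0 < δ) (hδT : δ < T)
    (hsmall : 2 * δ * (⨆ k, η k) * J * K < 1)
    (yseq : ℕ → Fin K → ℝ → ℝ)
    (h0 : ∀ k, ∀ t : ℝ, yseq 0 k t = 0)
    (hrec : ∀ n : ℕ, ∀ k, ∀ t : ℝ,
      yseq (n + 1) k t =
        ζ k t - η k * (∫ s in (0:ℝ)..t, yseq n k s)
          - ∑ j, p j k *
              psi (fun r => ξ j r + ∑ l, q l j * η l * (∫ s in (0:ℝ)..r, yseq n l s)) t) :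
    ∀ n : ℕ, 1 ≤ n → ∀ k,
      supNorm (fun t => yseq n k t - yseq (n - 1) k t) δ ≤
        (2 * δ * (⨆ k', η k') * J * K) ^ (n - 1) *
          ((⨆ k', supNorm (ζ k') δ) + ∑ j, supNorm (psi (ξ j)) δ) := by
  have hy : ∀ n k, BddMeasOn (yseq n k) δ := by
    intro n
    induction n with
    | zero =>
      intro k
      rw [show yseq 0 k = fun _ => 0 from funext (h0 k)]
      exact ⟨aestronglyMeasurable_const, 0, by simp⟩
    | succ n ih =>
      intro k
      rw [show yseq (n + 1) k = _ from funext (hrec n k)]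
      exact (((hζ k).bddMeasOn δ).sub ((ih k).integral.const_mul _)).sub
        (.sum _ fun j => (((hξ j).bddMeasOn δ).add
          (.sum _ fun l => (ih l).integral.const_mul _)).psi.const_mul _)
  have hx : ∀ n j, BddMeasOn
      (fun r => ξ j r + ∑ l, q l j * η l * (∫ s in (0:ℝ)..r, yseq n l s)) δ := fun n j =>
    ((hξ j).bddMeasOn δ).add (.sum _ fun l => (hy n l).integral.const_mul _)
  have hp1 : ∀ j k, p j k ≤ 1 := fun j k =>
    (Finset.single_le_sum (fun k _ => hp j k) (Finset.mem_univ k)).trans_eq (hprow j)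
  have hq1 : ∀ k j, q k j ≤ 1 := fun k j =>
    (Finset.single_le_sum (fun j _ => hq k j) (Finset.mem_univ j)).trans_eq (hqrow k)
  have hηle : ∀ k, η k ≤ ⨆ k, η k := le_ciSup (Set.finite_range η).bddAbove
  set H := ⨆ k, η k
  have hH : 0 ≤ H := (hη ⟨0, hK⟩).le.trans (hηle _)
  set C := (⨆ k', supNorm (ζ k') δ) + ∑ j, supNorm (psi (ξ j)) δ
  have key : ∀ n k, ∀ t ∈ Set.Icc 0 δ,
      |yseq (n + 1) k t - yseq n k t| ≤ (2 * δ * H * J * K) ^ n * C := by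
    intro n
    induction n with
    | zero =>
      intro k t ht
      have hζle := (((hζ k).bddMeasOn δ).abs_le_supNorm ht).trans
        (le_ciSup (f := fun k' => supNorm (ζ k') δ) (Set.finite_range _).bddAbove k)
      have hψ : |∑ j, p j k * psi (ξ j) t| ≤ ∑ j, supNorm (psi (ξ j)) δ := by
        refine (Finset.abs_sum_le_sum_abs _ _).trans (Finset.sum_le_sum fun j _ => ?_)
        rw [abs_mul, abs_of_nonneg (hp j k)]
        exact (mul_le_of_le_one_left (abs_nonneg _) (hp1 j k)).trans
          (((hξ j).bddMeasOn δ).psi.abs_le_supNorm ht)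
      rw [hrec]
      simp only [h0, intervalIntegral.integral_zero, mul_zero, Finset.sum_const_zero, add_zero,
        sub_zero, pow_zero, one_mul]
      exact (abs_sub _ _).trans (add_le_add hζle hψ)
    | succ n ih =>
      intro k t ht
      set B := (2 * δ * H * J * K) ^ n * C
      have hB0 : 0 ≤ B := (abs_nonneg _).trans (ih k t ht)
      have hI : ∀ l, ∀ r ∈ Set.Icc 0 δ,
          η l * |(∫ s in (0:ℝ)..r, yseq (n + 1) l s) - ∫ s in (0:ℝ)..r, yseq n l s|
            ≤ H * (B * δ) := fun l r hr =>
        mul_le_mul (hηle l) ((hy (n + 1) l).abs_integral_sub_integral_le (hy n l) hr (ih l))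
          (abs_nonneg _) hH
      have hψ : ∀ j, |psi (fun r => ξ j r + ∑ l, q l j * η l *
            (∫ s in (0:ℝ)..r, yseq (n + 1) l s)) t
          - psi (fun r => ξ j r + ∑ l, q l j * η l * (∫ s in (0:ℝ)..r, yseq n l s)) t|
          ≤ K * (H * (B * δ)) := by
        intro j
        refine (hx (n + 1) j).abs_psi_sub_psi_le (hx n j) ht fun r hr => ?_
        rw [add_sub_add_left_eq_sub, ← Finset.sum_sub_distrib]
        refine (Finset.abs_sum_le_sum_abs _ _).trans ?_
        refine (Finset.sum_le_card_nsmul _ _ (H * (B * δ)) fun l _ => ?_).trans_eq (by simp)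
        rw [← mul_sub, abs_mul, abs_of_nonneg (mul_nonneg (hq l j) (hη l).le), mul_assoc]
        exact (mul_le_of_le_one_left (mul_nonneg (hη l).le (abs_nonneg _)) (hq1 l j)).trans
          (hI l r ⟨hr.1, hr.2.trans ht.2⟩)
      have hsum : |∑ j, p j k * (psi (fun r => ξ j r + ∑ l, q l j * η l *
            (∫ s in (0:ℝ)..r, yseq (n + 1) l s)) t
          - psi (fun r => ξ j r + ∑ l, q l j * η l * (∫ s in (0:ℝ)..r, yseq n l s)) t)|
          ≤ J * (K * (H * (B * δ))) := by
        refine (Finset.abs_sum_le_sum_abs _ _).trans ?_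
        refine (Finset.sum_le_card_nsmul _ _ (K * (H * (B * δ))) fun j _ => ?_).trans_eq (by simp)
        rw [abs_mul, abs_of_nonneg (hp j k)]
        exact (mul_le_of_le_one_left (abs_nonneg _) (hp1 j k)).trans (hψ j)
      have hint := hI k t ht
      nth_rewrite 1 [← abs_of_nonneg (hη k).le] at hint
      rw [← abs_mul] at hint
      rw [hrec (n + 1), hrec n]
      simp only [mul_sub, Finset.sum_sub_distrib] at hsum hint
      have hJK : (1 : ℝ) ≤ J * K := by exact_mod_cast Nat.mul_pos hJ hK
      have hE : H * (B * δ) ≤ J * K * (H * (B * δ)) :=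
        le_mul_of_one_le_left (mul_nonneg hH (mul_nonneg hB0 hδ.le)) hJK
      have htotal : (2 * δ * H * J * K) ^ (n + 1) * C
          = J * K * (H * (B * δ)) + J * (K * (H * (B * δ))) := by
        simp only [B]
        ring
      rw [htotal]
      rw [abs_le] at hsum hint ⊢
      constructor <;> linarith [hsum.1, hsum.2, hint.1, hint.2]
  intro n hn k
  obtain ⟨m, rfl⟩ := Nat.exists_eq_add_of_le' hn
  refine csSup_le ((Set.nonempty_Icc.2 hδ.le).image _) ?_
  rintro _ ⟨t, ht, rfl⟩
  exact key m k t ht
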